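/- arXiv:1406.2101 — 6 statements merged into one kernel-verified Lean document; each statement's English description precedes it below -/
import Mathlib

section
/- Let K be a field, H a K-vector space, and B : H →ₗ[K] H →ₗ[K] K a bilinear form which is nondegenerate (if B x y = 0 for all y then x = 0, and if B x y = 0 for all x then y = 0). Let W : ℤ → Submodule K H be a family of subspaces such that B x y = 0 whenever x ∈ W h, y ∈ W k and h + k ≠ 0. If ⨆ k, W k = ⊤, then the family (W k)_{k ∈ ℤ} is independent (iSupIndep), so that H = ⊕_k W k. -/
/-- C∞-full implies C∞-pure (algebraic core): if a nondegenerate bilinear pairing on `H`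
vanishes on `W h × W k` whenever `h + k ≠ 0`, and the subspaces `W k` span `H`,
then the family `(W k)` is independent, so `H = ⊕ₖ W k`. -/
theorem stmt3 {K H : Type*} [Field K] [AddCommGroup H] [Module K H]
    (B : H →ₗ[K] H →ₗ[K] K)
    (hB1 : ∀ x : H, (∀ y : H, B x y = 0) → x = 0)
    (hB2 : ∀ y : H, (∀ x : H, B x y = 0) → y = 0)
    (W : ℤ → Submodule K H)
    (horth : ∀ h k : ℤ, h + k ≠ 0 → ∀ x ∈ W h, ∀ y ∈ W k, B x y = 0)
    (htop : (⨆ k, W k) = ⊤) :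
    iSupIndep W := by
  refine iSupIndep_def.mpr fun i ↦ Submodule.disjoint_def.mpr fun x hxi hx ↦ hB1 x ?_
  have hker : (⨆ k, W k) ≤ LinearMap.ker (B x) := by
    refine iSup_le fun k y hy ↦ LinearMap.mem_ker.mpr ?_
    by_cases hik : i + k = 0
    · have hle : (⨆ (j) (_ : j ≠ i), W j) ≤ LinearMap.ker (B.flip y) :=
        iSup₂_le fun j hj z hz ↦ LinearMap.mem_ker.mpr (horth j k (by lia) z hz y hy)
      exact LinearMap.mem_ker.mp (hle hx)
    · exact horth i k hik x hxi y hy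
  intro y
  exact LinearMap.mem_ker.mp (hker (htop ▸ Submodule.mem_top))
end

section
/- Let K be a field and M a K-vector space equipped with an internal ℤ-grading: a family U : ℤ → Submodule K M which is independent and satisfies ⨆ k, U k = ⊤. Let ∂, ∂̄ : M →ₗ[K] M be linear maps such that ∂ (U k) ⊆ U (k+1) and ∂̄ (U k) ⊆ U (k−1) for every k ∈ ℤ, and set d := ∂ + ∂̄ with d ∘ d = 0. Assume the ∂∂̄-Lemma: range ∂ ⊓ ker ∂̄ = range (∂ ∘ ∂̄) = range ∂̄ ⊓ ker ∂ (as submodules of M). Let H := ker d ⧸ im d with quotient map π and GH^(k) := π '' (U k ∩ ker d). Then ⨆ k, GH^(k) = ⊤ and the family (GH^(k))_{k ∈ ℤ} is independent; equivalently, every x ∈ ker d can be written as x = ∑_k x_k + d y with finitely many x_k ∈ U k ∩ ker d, and H = ⊕_k GH^(k). -/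
/-- The cohomology subgroup `GH^(k) = π '' (U k ∩ ker d)` of `H = ker d ⧸ im d`. -/
def GHsub {K M : Type*} [Field K] [AddCommGroup M] [Module K M]
    (d : M →ₗ[K] M) (S : Submodule K M) :
    Submodule K (↥(LinearMap.ker d) ⧸ (LinearMap.range d).comap (LinearMap.ker d).subtype) :=
  (S.comap (LinearMap.ker d).subtype).map
    ((LinearMap.range d).comap (LinearMap.ker d).subtype).mkQ

open DirectSum in
theorem decompose_apply_of_map_le {K M : Type*} [Field K] [AddCommGroup M] [Module K M]
    (U : ℤ → Submodule K M) [Decomposition U] {r : ℤ} {f : M →ₗ[K] M}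
    (hf : ∀ k, (U k).map f ≤ U (k + r)) (x : M) (k : ℤ) :
    (decompose U (f x) (k + r) : M) = f (decompose U x k) := by
  induction x using Decomposition.inductionOn U with
  | zero => simp
  | @homogeneous i m =>
    have hfm : f m ∈ U (i + r) := hf i ⟨m, m.2, rfl⟩
    rcases eq_or_ne i k with rfl | hik
    · rw [decompose_of_mem_same U hfm, decompose_of_mem_same U m.2]
    · rw [decompose_of_mem_ne U hfm (by lia), decompose_of_mem_ne U m.2 hik, map_zero]
  | add x y hx hy => simp [hx, hy]

open DirectSum in
/-- The components of `(p + q)² = 0` of degrees `2`, `0` and `-2`, for `p` and `q` of degrees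
`1` and `-1`. -/
theorem bigraded_relations_of_sq_eq_zero {K M : Type*} [Field K] [AddCommGroup M] [Module K M]
    (U : ℤ → Submodule K M) [Decomposition U] {p q : M →ₗ[K] M}
    (hp : ∀ k, (U k).map p ≤ U (k + 1)) (hq : ∀ k, (U k).map q ≤ U (k - 1))
    (hd : (p + q) ∘ₗ (p + q) = 0) (x : M) :
    p (p x) = 0 ∧ q (q x) = 0 ∧ q (p x) = -p (q x) := by
  induction x using Decomposition.inductionOn U with
  | zero => simp
  | @homogeneous i m =>
    have hpm : p m ∈ U (i + 1) := hp i ⟨m, m.2, rfl⟩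
    have hqm : q m ∈ U (i - 1) := hq i ⟨m, m.2, rfl⟩
    have hpp : p (p m) ∈ U (i + 2) := by
      simpa [add_assoc] using hp (i + 1) ⟨_, hpm, rfl⟩
    have hqq : q (q m) ∈ U (i - 2) := by
      simpa [sub_sub] using hq (i - 1) ⟨_, hqm, rfl⟩
    have hpq : p (q m) ∈ U i := by simpa using hp (i - 1) ⟨_, hqm, rfl⟩
    have hqp : q (p m) ∈ U i := by simpa using hq (i + 1) ⟨_, hpm, rfl⟩
    have hsum : p (p m) + (q (p m) + p (q m)) + q (q m) = 0 := by
      have h := LinearMap.congr_fun hd (m : M)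
      simp only [LinearMap.comp_apply, LinearMap.add_apply, map_add, LinearMap.zero_apply] at h
      rw [← h]
      abel
    have hpp0 : p (p m) = 0 := by
      have h := congrArg (fun y => (decompose U y (i + 2) : M)) hsum
      simpa only [decompose_add, decompose_zero, DirectSum.add_apply, DirectSum.zero_apply, Submodule.coe_add,
        ZeroMemClass.coe_zero, decompose_of_mem_same U hpp,
        decompose_of_mem_ne U hqp (show i ≠ i + 2 by lia),
        decompose_of_mem_ne U hpq (show i ≠ i + 2 by lia),
        decompose_of_mem_ne U hqq (show i - 2 ≠ i + 2 by lia), add_zero] using h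
    have hqq0 : q (q m) = 0 := by
      have h := congrArg (fun y => (decompose U y (i - 2) : M)) hsum
      simpa only [hpp0, decompose_add, decompose_zero, DirectSum.add_apply, DirectSum.zero_apply, Submodule.coe_add,
        ZeroMemClass.coe_zero, decompose_of_mem_same U hqq,
        decompose_of_mem_ne U hqp (show i ≠ i - 2 by lia),
        decompose_of_mem_ne U hpq (show i ≠ i - 2 by lia), zero_add] using h
    rw [hpp0, hqq0, zero_add, add_zero] at hsum
    exact ⟨hpp0, hqq0, eq_neg_of_add_eq_zero_left hsum⟩
  | add x y hx hy =>
    refine ⟨by simp [hx.1, hy.1], by simp [hx.2.1, hy.2.1], ?_⟩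
    simp only [map_add, hx.2.2, hy.2.2, neg_add]

/-- Every `(p + q)`-closed element is cohomologous to one that is both `p`- and `q`-closed. -/
theorem exists_sub_closed_of_range_inf_ker_eq {K M : Type*} [Field K] [AddCommGroup M]
    [Module K M] {p q : M →ₗ[K] M}
    (hrel : ∀ x, p (p x) = 0 ∧ q (q x) = 0 ∧ q (p x) = -p (q x))
    (hlemma : LinearMap.range p ⊓ LinearMap.ker q = LinearMap.range (p ∘ₗ q))
    {x : M} (hx : (p + q) x = 0) :
    ∃ z, p (x - (p + q) z) = 0 ∧ q (x - (p + q) z) = 0 := by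
  rw [LinearMap.add_apply] at hx
  have hqx : q x = -p x := eq_neg_of_add_eq_zero_right hx
  have hmem : p x ∈ LinearMap.range (p ∘ₗ q) := by
    rw [← hlemma]
    exact ⟨⟨x, rfl⟩, by simp [hrel, hqx]⟩
  obtain ⟨z, hz⟩ := hmem
  rw [LinearMap.comp_apply] at hz
  exact ⟨z, by simp [hrel, hz], by simp [hrel, hz, hqx]⟩

/-- A `(p + q)`-exact element that is both `p`- and `q`-closed lies in the range of `p ∘ q`. -/
theorem mem_range_comp_of_exact_of_closed {K M : Type*} [Field K] [AddCommGroup M]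
    [Module K M] {p q : M →ₗ[K] M} (hrel : ∀ x, p (p x) = 0 ∧ q (q x) = 0)
    (hlemma1 : LinearMap.range p ⊓ LinearMap.ker q = LinearMap.range (p ∘ₗ q))
    (hlemma2 : LinearMap.range (p ∘ₗ q) = LinearMap.range q ⊓ LinearMap.ker p)
    {y : M} (hpy : p ((p + q) y) = 0) (hqy : q ((p + q) y) = 0) :
    (p + q) y ∈ LinearMap.range (p ∘ₗ q) := by
  simp only [LinearMap.add_apply, map_add, hrel, zero_add, add_zero] at hpy hqy
  rw [LinearMap.add_apply]
  refine add_mem ?_ ?_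
  · rw [← hlemma1]
    exact ⟨⟨y, rfl⟩, hqy⟩
  · rw [hlemma2]
    exact ⟨⟨y, rfl⟩, hpy⟩

/-- The ∂∂̄-Lemma implies C∞-pure-and-fullness (algebraic model, after Cavalcanti):
if `im ∂ ⊓ ker ∂̄ = im (∂∘∂̄) = im ∂̄ ⊓ ker ∂`, then the subgroups `GH^(k)` give a
direct sum decomposition of `H = ker d ⧸ im d`. -/
theorem stmt4 {K M : Type*} [Field K] [AddCommGroup M] [Module K M]
    (U : ℤ → Submodule K M) (hindep : iSupIndep U) (htop : (⨆ k, U k) = ⊤)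
    (p q : M →ₗ[K] M)
    (hp : ∀ k : ℤ, (U k).map p ≤ U (k + 1))
    (hq : ∀ k : ℤ, (U k).map q ≤ U (k - 1))
    (hd : (p + q) ∘ₗ (p + q) = 0)
    (hlemma1 : LinearMap.range p ⊓ LinearMap.ker q = LinearMap.range (p ∘ₗ q))
    (hlemma2 : LinearMap.range (p ∘ₗ q) = LinearMap.range q ⊓ LinearMap.ker p) :
    (⨆ k, GHsub (p + q) (U k)) = ⊤ ∧ iSupIndep (fun k => GHsub (p + q) (U k)) := by
  classical
  let _ : DirectSum.Decomposition U :=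
    (DirectSum.isInternal_submodule_of_iSupIndep_of_iSup_eq_top hindep htop).chooseDecomposition
  have hq' : ∀ k : ℤ, (U k).map q ≤ U (k + -1) := hq
  have hpq : ∀ k : ℤ, (U k).map (p ∘ₗ q) ≤ U (k + 0) := by
    rintro k _ ⟨x, hx, rfl⟩
    simpa using hp (k - 1) ⟨q x, hq k ⟨x, hx, rfl⟩, rfl⟩
  have hrel := bigraded_relations_of_sq_eq_zero U hp hq hd
  have hclosed : ∀ (w : M), p w = 0 → q w = 0 → ∀ k,
      p (DirectSum.decompose U w k) = 0 ∧ q (DirectSum.decompose U w k) = 0 := by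
    intro w hpw hqw k
    rw [← decompose_apply_of_map_le U hp, ← decompose_apply_of_map_le U hq', hpw, hqw]
    simp
  constructor
  · rw [eq_top_iff]
    rintro h -
    obtain ⟨⟨x, hx⟩, rfl⟩ := Submodule.mkQ_surjective _ h
    obtain ⟨z, hpz, hqz⟩ := exists_sub_closed_of_range_inf_ker_eq hrel hlemma1 hx
    set w := x - (p + q) z with hw
    have hwk (k : ℤ) : (DirectSum.decompose U w k : M) ∈ LinearMap.ker (p + q) := by
      simp [hclosed w hpz hqz k]
    have hx_eq : Submodule.mkQ ((LinearMap.range (p + q)).comap (LinearMap.ker (p + q)).subtype)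
        ⟨x, hx⟩ = Submodule.mkQ _
          (∑ k ∈ (DirectSum.decompose U w).support, ⟨_, hwk k⟩) := by
      refine (Submodule.Quotient.eq _).2 ⟨z, ?_⟩
      rw [Submodule.subtype_apply, Submodule.coe_sub, Submodule.coe_sum,
        DirectSum.sum_support_decompose U w, hw, sub_sub_cancel]
    rw [hx_eq, map_sum]
    exact sum_mem fun k _ => Submodule.mem_iSup_of_mem k
      ⟨⟨_, hwk k⟩, (DirectSum.decompose U w k).2, rfl⟩
  · rw [iSupIndep_iff_finsetSum_eq_zero_imp_eq_zero]
    intro s v hv hsum k hk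
    have hrep : ∀ i, ∃ u : LinearMap.ker (p + q), i ∈ s → (u : M) ∈ U i ∧
        Submodule.mkQ ((LinearMap.range (p + q)).comap (LinearMap.ker (p + q)).subtype) u
          = v i := by
      intro i
      by_cases hi : i ∈ s
      · obtain ⟨u, hu, huv⟩ := hv i hi
        exact ⟨u, fun _ => ⟨hu, huv⟩⟩
      · exact ⟨0, fun h => absurd h hi⟩
    choose u hu using hrep
    have hu_closed (i : ℤ) (hi : i ∈ s) : p (u i) = 0 ∧ q (u i) = 0 := by
      have hpu : p (u i) ∈ U (i + 1) := hp i ⟨_, (hu i hi).1, rfl⟩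
      have hqu : q (u i) ∈ U (i - 1) := hq i ⟨_, (hu i hi).1, rfl⟩
      have hsum0 : p (u i) + q (u i) = 0 := (u i).2
      have hp0 := Submodule.disjoint_def.1 (hindep.pairwiseDisjoint (show i + 1 ≠ i - 1 by lia))
        _ hpu (by rw [eq_neg_of_add_eq_zero_left hsum0]; exact neg_mem hqu)
      exact ⟨hp0, by simpa [hp0] using hsum0⟩
    obtain ⟨y, hy⟩ : ∃ y, (p + q) y = ∑ i ∈ s, (u i : M) := by
      rw [← Finset.sum_congr rfl fun i hi => (hu i hi).2, ← map_sum] at hsum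
      obtain ⟨y, hy⟩ := (Submodule.Quotient.mk_eq_zero _).1 hsum
      exact ⟨y, by simpa using hy⟩
    obtain ⟨c, hc⟩ := mem_range_comp_of_exact_of_closed (fun x => ⟨(hrel x).1, (hrel x).2.1⟩)
      hlemma1 hlemma2
      (by rw [hy, map_sum]; exact Finset.sum_eq_zero fun i hi => (hu_closed i hi).1)
      (by rw [hy, map_sum]; exact Finset.sum_eq_zero fun i hi => (hu_closed i hi).2)
    have hcomp : (DirectSum.decompose U (∑ i ∈ s, (u i : M)) k : M) = u k := by
      rw [DirectSum.decompose_sum, DFinsupp.finsetSum_apply, Submodule.coe_sum,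
        Finset.sum_eq_single_of_mem k hk fun i hi hik =>
          DirectSum.decompose_of_mem_ne U (hu i hi).1 hik]
      exact DirectSum.decompose_of_mem_same U (hu k hk).1
    rw [← (hu k hk).2]
    refine (Submodule.Quotient.mk_eq_zero _).2 ⟨q (DirectSum.decompose U c k), ?_⟩
    have hck := decompose_apply_of_map_le U hpq c k
    rw [hc, hy, add_zero, hcomp] at hck
    simp [hck, hrel]
end

section
/- Let K be a field and M a K-vector space equipped with an internal ℤ×ℤ-bigrading: a family W : ℤ × ℤ → Submodule K M which is independent and satisfies ⨆ (p,q), W (p,q) = ⊤. Let d : M →ₗ[K] M with d ∘ d = 0, and suppose d = A + ∂ + ∂̄ + Ā where A, ∂, ∂̄, Ā are linear maps with A (W (p,q)) ⊆ W (p+2, q−1), ∂ (W (p,q)) ⊆ W (p+1, q), ∂̄ (W (p,q)) ⊆ W (p, q+1), Ā (W (p,q)) ⊆ W (p−1, q+2) for all (p,q). Fix k ∈ ℤ and let x ∈ ⨆_{(p,q) : p−q=k} W (p,q) with d x = 0. Then, writing x = ∑_{(p,q)} x^{(p,q)} with x^{(p,q)} ∈ W (p,q) the (finitely supported) components of x under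 the bigrading, each component satisfies d x^{(p,q)} = 0; moreover A x^{(p,q)} = ∂ x^{(p,q)} = ∂̄ x^{(p,q)} = Ā x^{(p,q)} = 0 for every (p,q). -/
/-- The projections onto the summands of an internal direct sum, as endomorphisms. -/
theorem iSupIndep.exists_proj {ι R M : Type*} [DecidableEq ι] [Ring R] [AddCommGroup M]
    [Module R M] {W : ι → Submodule R M} (hindep : iSupIndep W) (htop : (⨆ i, W i) = ⊤) :
    ∃ π : ι → M →ₗ[R] M, ∀ i, ∀ v ∈ W i, ∀ j, π j v = if j = i then v else 0 := by
  have hint := DirectSum.isInternal_submodule_of_iSupIndep_of_iSup_eq_top hindep htop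
  let _ : DirectSum.Decomposition W := hint.chooseDecomposition
  refine ⟨fun j => (W j).subtype ∘ₗ DirectSum.component R ι (fun i => W i) j ∘ₗ
    (DirectSum.decomposeLinearEquiv W).toLinearMap, fun i v hv j => ?_⟩
  change ((DirectSum.decompose W v) j : M) = _
  split_ifs with h
  · subst h
    exact DirectSum.decompose_of_mem_same W hv
  · exact DirectSum.decompose_of_mem_ne W hv (Ne.symm h)

/-- Algebraic model of the bidegree decomposition for an almost-complex structure:
if `d = A + ∂ + ∂̄ + Ā` with the four components of bidegrees `(+2,-1)`, `(+1,0)`,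
`(0,+1)`, `(-1,+2)` with respect to an internal ℤ×ℤ-bigrading, `d ∘ d = 0`, and
`x ∈ ⨆_{p-q=k} W(p,q)` is `d`-closed, then each bigraded component `x^{(p,q)}` of `x`
is `d`-closed, and moreover killed by each of `A`, `∂`, `∂̄`, `Ā`. -/
theorem stmt7 {K M : Type*} [Field K] [AddCommGroup M] [Module K M]
    (W : ℤ × ℤ → Submodule K M) (hindep : iSupIndep W) (htop : (⨆ pq, W pq) = ⊤)
    (d A p q Abar : M →ₗ[K] M)
    (hsum : d = A + p + q + Abar)
    (hA : ∀ pq : ℤ × ℤ, (W pq).map A ≤ W (pq.1 + 2, pq.2 - 1))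
    (hp : ∀ pq : ℤ × ℤ, (W pq).map p ≤ W (pq.1 + 1, pq.2))
    (hq : ∀ pq : ℤ × ℤ, (W pq).map q ≤ W (pq.1, pq.2 + 1))
    (hAbar : ∀ pq : ℤ × ℤ, (W pq).map Abar ≤ W (pq.1 - 1, pq.2 + 2))
    (hd : d ∘ₗ d = 0)
    (k : ℤ) (x : M)
    (hx : x ∈ ⨆ (pq : ℤ × ℤ) (_ : pq.1 - pq.2 = k), W pq)
    (hxd : d x = 0)
    (c : (ℤ × ℤ) →₀ M) (hc : ∀ pq : ℤ × ℤ, c pq ∈ W pq)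
    (hcx : x = c.sum fun _ v => v) :
    ∀ pq : ℤ × ℤ, d (c pq) = 0 ∧ A (c pq) = 0 ∧ p (c pq) = 0 ∧
      q (c pq) = 0 ∧ Abar (c pq) = 0 := by
  obtain ⟨π, hπ⟩ := hindep.exists_proj htop
  have hdiag : ∀ i, c i ≠ 0 → i.1 - i.2 = k := by
    intro i hi
    by_contra hk
    refine hi ?_
    have hker : (⨆ (pq : ℤ × ℤ) (_ : pq.1 - pq.2 = k), W pq) ≤ LinearMap.ker (π i) :=
      iSup₂_le fun j hj v hv => by
        rw [LinearMap.mem_ker, hπ j v hv, if_neg]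
        rintro rfl
        exact hk hj
    have h0 : π i x = 0 := hker hx
    rw [hcx, Finsupp.sum, map_sum] at h0
    simpa [hπ _ _ (hc _)] using h0
  have hcomp : ∀ (i t : ℤ × ℤ) (T : M →ₗ[K] M),
      (∀ j, i.1 - i.2 = k → j.1 - j.2 = k → π t (d (c j)) = if i = j then T (c j) else 0) →
      T (c i) = 0 := by
    intro i t T hT
    by_cases hi : c i = 0
    · rw [hi, map_zero]
    have h0 : π t (d x) = 0 := by rw [hxd, map_zero]
    rw [hcx, Finsupp.sum, map_sum, map_sum, Finset.sum_congr rfl fun j hj =>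
      hT j (hdiag i hi) (hdiag j (Finsupp.mem_support_iff.mp hj))] at h0
    simpa [hi] using h0
  have hproj : ∀ j t, π t (d (c j)) =
      (if t = (j.1 + 2, j.2 - 1) then A (c j) else 0) +
      (if t = (j.1 + 1, j.2) then p (c j) else 0) +
      (if t = (j.1, j.2 + 1) then q (c j) else 0) +
      (if t = (j.1 - 1, j.2 + 2) then Abar (c j) else 0) := by
    intro j t
    simp only [hsum, LinearMap.add_apply, map_add,
      hπ _ _ (hA j (Submodule.mem_map_of_mem (hc j))),
      hπ _ _ (hp j (Submodule.mem_map_of_mem (hc j))),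
      hπ _ _ (hq j (Submodule.mem_map_of_mem (hc j))),
      hπ _ _ (hAbar j (Submodule.mem_map_of_mem (hc j)))]
  intro i
  have h1 : A (c i) = 0 := hcomp i (i.1 + 2, i.2 - 1) A fun j hi hj => by
    rw [hproj]; simp only [Prod.ext_iff]; grind
  have h2 : p (c i) = 0 := hcomp i (i.1 + 1, i.2) p fun j hi hj => by
    rw [hproj]; simp only [Prod.ext_iff]; grind
  have h3 : q (c i) = 0 := hcomp i (i.1, i.2 + 1) q fun j hi hj => by
    rw [hproj]; simp only [Prod.ext_iff]; grind
  have h4 : Abar (c i) = 0 := hcomp i (i.1 - 1, i.2 + 2) Abar fun j hi hj => by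
    rw [hproj]; simp only [Prod.ext_iff]; grind
  exact ⟨by simp [hsum, h1, h2, h3, h4], h1, h2, h3, h4⟩
end

section
/- Let K be a field and M a K-vector space equipped with an internal ℤ×ℤ-bigrading: a family W : ℤ × ℤ → Submodule K M which is independent and satisfies ⨆ (p,q), W (p,q) = ⊤. Let d : M →ₗ[K] M with d ∘ d = 0, and suppose d = A + ∂ + ∂̄ + Ā where A, ∂, ∂̄, Ā are linear maps with A (W (p,q)) ⊆ W (p+2, q−1), ∂ (W (p,q)) ⊆ W (p+1, q), ∂̄ (W (p,q)) ⊆ W (p, q+1), Ā (W (p,q)) ⊆ W (p−1, q+2) for all (p,q). Let H := ker d ⧸ im d with quotient map π, let H^(p,q) := π '' (W (p,q) ∩ ker d), and for k ∈ ℤ let U k := ⨆_{(p,q) : p−q=k} W (p,q) and GH^(k) := π '' (U k ∩ ker d). Then for every k ∈ ℤ one has GH^(k) = ⨆_{(p,q) : p−q=k} H^(p,q), and the family (H^(p,q))_{(p,q) : p−q=k} is independent, so GH^(k) = ⊕_{p−q=k} H^(p,q). -/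
/-- The cohomology subgroup `π '' (S ∩ ker d)` of `H = ker d ⧸ im d`. -/
def cohSub {K M : Type*} [Field K] [AddCommGroup M] [Module K M]
    (d : M →ₗ[K] M) (S : Submodule K M) :
    Submodule K (↥(LinearMap.ker d) ⧸ (LinearMap.range d).comap (LinearMap.ker d).subtype) :=
  (S.comap (LinearMap.ker d).subtype).map
    ((LinearMap.range d).comap (LinearMap.ker d).subtype).mkQ

/-- The projections onto the total-degree pieces of a bigraded module. -/
lemma exists_totalDegree_projection {K M : Type*} [Field K] [AddCommGroup M] [Module K M]
    (W : ℤ × ℤ → Submodule K M) (hindep : iSupIndep W) (htop : (⨆ pq, W pq) = ⊤) :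
    ∃ P : ℤ → M →ₗ[K] M, ∀ (n : ℤ) (i : ℤ × ℤ), ∀ x ∈ W i,
      P n x = if i.1 + i.2 = n then x else 0 := by
  classical
  have hint : DirectSum.IsInternal W :=
    DirectSum.isInternal_submodule_of_iSupIndep_of_iSup_eq_top hindep htop
  let e : (DirectSum (ℤ × ℤ) fun i => W i) ≃ₗ[K] M :=
    LinearEquiv.ofBijective (DirectSum.coeLinearMap W) hint
  refine ⟨fun n => (DirectSum.toModule K (ℤ × ℤ) M fun i =>
    if i.1 + i.2 = n then (W i).subtype else 0) ∘ₗ e.symm.toLinearMap, fun n i x hx => ?_⟩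
  have hx' : e.symm x = DirectSum.lof K (ℤ × ℤ) (fun i => W i) i ⟨x, hx⟩ := by
    rw [LinearEquiv.symm_apply_eq]
    exact (DirectSum.coeLinearMap_lof W i ⟨x, hx⟩).symm
  simp only [LinearMap.comp_apply, LinearEquiv.coe_coe, hx', DirectSum.toModule_lof]
  split_ifs <;> rfl

lemma cohSub_mono {K M : Type*} [Field K] [AddCommGroup M] [Module K M]
    (d : M →ₗ[K] M) {S T : Submodule K M} (h : S ≤ T) : cohSub d S ≤ cohSub d T :=
  Submodule.map_mono (Submodule.comap_mono h)

/-- If each `W i` is fixed by an endomorphism `P i` that intertwines with `d` and kills the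
other `W j`, then the subgroups of cohomology classes represented in the `W i` are independent. -/
lemma iSupIndep_cohSub {K M ι : Type*} [Field K] [AddCommGroup M] [Module K M]
    (d : M →ₗ[K] M) (W : ι → Submodule K M) (P P₁ P₂ : ι → M →ₗ[K] M)
    (hP₁ : ∀ i x, P₁ i (d x) = d (P i x)) (hP₂ : ∀ i x, P i (d x) = d (P₂ i x))
    (hself : ∀ i, ∀ x ∈ W i, P i x = x)
    (hne : ∀ i j, j ≠ i → ∀ x ∈ W j, P i x = 0) :
    iSupIndep fun i => cohSub d (W i) := by
  intro i
  have hker : ∀ x ∈ LinearMap.ker d, P i x ∈ LinearMap.ker d := fun x hx => by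
    rw [LinearMap.mem_ker] at hx ⊢
    rw [← hP₁, hx, map_zero]
  let R := (LinearMap.range d).comap (LinearMap.ker d).subtype
  have hR : R ≤ R.comap ((P i).restrict hker) := by
    rintro x ⟨y, hy⟩
    exact ⟨P₂ i y, by rw [← hP₂, hy]; rfl⟩
  let Q := R.mapQ R ((P i).restrict hker) hR
  rw [Submodule.disjoint_def]
  intro x hx hx'
  have hfix : Q x = x := by
    obtain ⟨y, hy, rfl⟩ := hx
    exact congrArg R.mkQ (Subtype.ext (hself i y hy))
  have hle : (⨆ (j) (_ : j ≠ i), cohSub d (W j)) ≤ LinearMap.ker Q := by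
    refine iSup₂_le fun j hj => ?_
    rintro _ ⟨y, hy, rfl⟩
    have hy0 : (P i).restrict hker y = 0 := Subtype.ext (hne i j hj y hy)
    change R.mkQ ((P i).restrict hker y) = 0
    rw [hy0, map_zero]
  rw [← hfix]
  exact hle hx'

/-- The Lemma `GH^(k)_𝒥 = ⊕_{p-q=k} H^(p,q)_J` (algebraic model): with a
ℤ×ℤ-bigrading `W`, `d = A + ∂ + ∂̄ + Ā` of bidegrees `(+2,-1)`, `(+1,0)`, `(0,+1)`,
`(-1,+2)`, `U k = ⨆_{p-q=k} W(p,q)`, `H^(p,q) = π '' (W(p,q) ∩ ker d)` and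
`GH^(k) = π '' (U k ∩ ker d)`, one has `GH^(k) = ⨆_{p-q=k} H^(p,q)` and the family
`(H^(p,q))_{p-q=k}` is independent. -/
theorem stmt8 {K M : Type*} [Field K] [AddCommGroup M] [Module K M]
    (W : ℤ × ℤ → Submodule K M) (hindep : iSupIndep W) (htop : (⨆ pq, W pq) = ⊤)
    (d A p q Abar : M →ₗ[K] M)
    (hsum : d = A + p + q + Abar)
    (hA : ∀ pq : ℤ × ℤ, (W pq).map A ≤ W (pq.1 + 2, pq.2 - 1))
    (hp : ∀ pq : ℤ × ℤ, (W pq).map p ≤ W (pq.1 + 1, pq.2))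
    (hq : ∀ pq : ℤ × ℤ, (W pq).map q ≤ W (pq.1, pq.2 + 1))
    (hAbar : ∀ pq : ℤ × ℤ, (W pq).map Abar ≤ W (pq.1 - 1, pq.2 + 2))
    (hd : d ∘ₗ d = 0) :
    (∀ k : ℤ,
        cohSub d (⨆ (pq : ℤ × ℤ) (_ : pq.1 - pq.2 = k), W pq)
          = ⨆ (pq : ℤ × ℤ) (_ : pq.1 - pq.2 = k), cohSub d (W pq)) ∧
    (∀ k : ℤ,
        iSupIndep (fun pq : {pq : ℤ × ℤ // pq.1 - pq.2 = k} => cohSub d (W pq.1))) := by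
  obtain ⟨P, hP⟩ := exists_totalDegree_projection W hindep htop
  have hcomm : ∀ n x, P (n + 1) (d x) = d (P n x) := by
    intro n x
    have hx : x ∈ ⨆ i, W i := htop ▸ Submodule.mem_top
    induction hx using Submodule.iSup_induction' with
    | zero => simp
    | add x y _ _ hx hy => simp only [map_add, hx, hy]
    | mem i x hx =>
      have h1 := hP (n + 1) _ _ (hA i ⟨x, hx, rfl⟩)
      have h2 := hP (n + 1) _ _ (hp i ⟨x, hx, rfl⟩)
      have h3 := hP (n + 1) _ _ (hq i ⟨x, hx, rfl⟩)
      have h4 := hP (n + 1) _ _ (hAbar i ⟨x, hx, rfl⟩)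
      rw [hP n i x hx, hsum]
      simp only [LinearMap.add_apply, map_add, h1, h2, h3, h4]
      by_cases h : i.1 + i.2 = n
      · rw [if_pos (by omega), if_pos (by omega), if_pos (by omega), if_pos (by omega), if_pos h]
      · rw [if_neg (by omega), if_neg (by omega), if_neg (by omega), if_neg (by omega), if_neg h]
        simp
  refine ⟨fun k => le_antisymm ?_ (iSup₂_le fun i hi => cohSub_mono d (le_iSup₂_of_le i hi le_rfl)),
    fun k => ?_⟩
  · rintro _ ⟨⟨a, ha⟩, haU, rfl⟩
    change a ∈ ⨆ (i : ℤ × ℤ) (_ : i.1 - i.2 = k), W i at haU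
    rw [iSup_subtype', Submodule.mem_iSup_iff_exists_finsupp] at haU
    obtain ⟨f, hf, hfa⟩ := haU
    have hproj : ∀ i, P (i.1.1 + i.1.2) a = f i := by
      intro i
      rw [← hfa, Finsupp.sum, map_sum, Finset.sum_eq_single i]
      · rw [hP _ _ _ (hf i), if_pos rfl]
      · intro j _ hj
        rw [hP _ _ _ (hf j), if_neg]
        intro h
        have hi := i.2
        have hj' := j.2
        exact hj (Subtype.ext (Prod.ext (by omega) (by omega)))
      · intro hi
        rw [Finsupp.notMem_support_iff.mp hi, map_zero]
    have hclosed : ∀ i, f i ∈ LinearMap.ker d := fun i => by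
      rw [LinearMap.mem_ker, ← hproj, ← hcomm, LinearMap.mem_ker.mp ha, map_zero]
    have hsum' : (⟨a, ha⟩ : LinearMap.ker d) = ∑ i ∈ f.support, ⟨f i, hclosed i⟩ := by
      apply Subtype.ext
      rw [AddSubmonoidClass.coe_finsetSum]
      exact hfa.symm
    rw [hsum', map_sum]
    exact Submodule.sum_mem _ fun i _ =>
      Submodule.mem_iSup_of_mem i.1 (Submodule.mem_iSup_of_mem i.2 ⟨⟨f i, hclosed i⟩, hf i, rfl⟩)
  · refine iSupIndep_cohSub d (fun i : {i : ℤ × ℤ // i.1 - i.2 = k} => W i.1)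
      (fun i => P (i.1.1 + i.1.2)) (fun i => P (i.1.1 + i.1.2 + 1))
      (fun i => P (i.1.1 + i.1.2 - 1)) (fun i => hcomm _) (fun i x => ?_)
      (fun i x hx => by rw [hP _ _ _ hx, if_pos rfl]) (fun i j hj x hx => ?_)
    · rw [← hcomm, sub_add_cancel]
    · rw [hP _ _ _ hx, if_neg]
      intro h
      have hi := i.2
      have hj' := j.2
      exact hj (Subtype.ext (Prod.ext (by omega) (by omega)))
end

section
/- Let K be a field and M a K-vector space equipped with an internal ℤ×ℤ-bigrading: a family W : ℤ × ℤ → Submodule K M which is independent and satisfies ⨆ (p,q), W (p,q) = ⊤. Let d : M →ₗ[K] M with d ∘ d = 0, and suppose d = A + ∂ + ∂̄ + Ā where A, ∂, ∂̄, Ā are linear maps with A (W (p,q)) ⊆ W (p+2, q−1), ∂ (W (p,q)) ⊆ W (p+1, q), ∂̄ (W (p,q)) ⊆ W (p, q+1), Ā (W (p,q)) ⊆ W (p−1, q+2) for all (p,q). Let H := ker d ⧸ im d with quotient map π, let H^(p,q) := π '' (W (p,q) ∩ ker d), and for k ∈ ℤ let U k := ⨆_{(p,q) : p−q=k} W (p,q)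 and GH^(k) := π '' (U k ∩ ker d). Then the following are equivalent: (i) ⨆ k, GH^(k) = ⊤ and the family (GH^(k))_{k ∈ ℤ} is independent; (ii) ⨆ (p,q), H^(p,q) = ⊤ and the family (H^(p,q))_{(p,q) ∈ ℤ×ℤ} is independent. -/
/-- Over a field with an internal direct sum indexed by `ι`, every map `f : ι → κ` gives a family
of linear projections onto the coarser pieces `⨆_{f i = n} W i`. -/
lemma exists_coarse_projections {K M ι κ : Type*} [Field K] [AddCommGroup M] [Module K M]
    (W : ι → Submodule K M) (hindep : iSupIndep W) (htop : (⨆ i, W i) = ⊤) (f : ι → κ) :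
    ∃ P : κ → M →ₗ[K] M, (∀ i, ∀ x ∈ W i, P (f i) x = x) ∧
      ∀ i n, f i ≠ n → ∀ x ∈ W i, P n x = 0 := by
  classical
  have hW := DirectSum.isInternal_submodule_of_iSupIndep_of_iSup_eq_top hindep htop
  let e := LinearEquiv.ofBijective (DirectSum.coeLinearMap W) hW
  have he : ∀ i, ∀ x (hx : x ∈ W i), e.symm x = DirectSum.lof K ι (fun i => W i) i ⟨x, hx⟩ := by
    intro i x hx
    rw [LinearEquiv.symm_apply_eq]
    exact (DirectSum.coeLinearMap_lof W i ⟨x, hx⟩).symm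
  refine ⟨fun n => (DirectSum.toModule K ι M fun i => if f i = n then (W i).subtype else 0) ∘ₗ
    e.symm.toLinearMap, fun i x hx => ?_, fun i n hn x hx => ?_⟩
  · simp [he i x hx]
  · simp [he i x hx, hn]

lemma exists_finset_sum_coarse_projections_eq {K M ι κ : Type*} [Field K] [AddCommGroup M]
    [Module K M] {W : ι → Submodule K M} (htop : (⨆ i, W i) = ⊤) {f : ι → κ}
    {P : κ → M →ₗ[K] M} (hP : ∀ i, ∀ x ∈ W i, P (f i) x = x)
    (hP' : ∀ i n, f i ≠ n → ∀ x ∈ W i, P n x = 0) (x : M) :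
    ∃ s : Finset κ, ∑ n ∈ s, P n x = x := by
  classical
  suffices h : ∃ s : Finset κ, ∀ t, s ⊆ t → ∑ n ∈ t, P n x = x from
    h.imp fun s hs => hs s subset_rfl
  have hx : x ∈ ⨆ i, W i := htop ▸ Submodule.mem_top
  induction hx using Submodule.iSup_induction' with
  | mem i x hx =>
    refine ⟨{f i}, fun t ht => ?_⟩
    rw [Finset.sum_eq_single_of_mem (f i) (by simpa using ht), hP i x hx]
    exact fun n _ hn => hP' i n hn.symm x hx
  | zero => exact ⟨∅, by simp⟩
  | add x y _ _ hx hy =>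
    obtain ⟨s, hs⟩ := hx
    obtain ⟨t, ht⟩ := hy
    refine ⟨s ∪ t, fun u hu => ?_⟩
    simp only [map_add, Finset.sum_add_distrib]
    rw [hs u (Finset.union_subset_left hu), ht u (Finset.union_subset_right hu)]

/-- A linear map `T` commuting with `d` up to replacing it by `T'` and `T''` on either side
induces a map on cohomology, fixing the classes represented in a subspace fixed by `T` and killing
those represented in a subspace killed by `T`. -/
lemma exists_cohomology_map {K M : Type*} [Field K] [AddCommGroup M] [Module K M]
    (d T T' T'' : M →ₗ[K] M) (h : ∀ x, T (d x) = d (T' x)) (h' : ∀ x, T'' (d x) = d (T x)) :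
    ∃ Q : Module.End K
        (↥(LinearMap.ker d) ⧸ (LinearMap.range d).comap (LinearMap.ker d).subtype),
      (∀ S : Submodule K M, (∀ x ∈ S, T x = x) → ∀ v ∈ cohSub d S, Q v = v) ∧
      ∀ S : Submodule K M, (∀ x ∈ S, T x = 0) → ∀ v ∈ cohSub d S, Q v = 0 := by
  have hker : ∀ x ∈ LinearMap.ker d, T x ∈ LinearMap.ker d := by
    intro x hx
    rw [LinearMap.mem_ker] at hx ⊢
    rw [← h', hx, map_zero]
  refine ⟨Submodule.mapQ _ _ (T.restrict hker) ?_, ?_, ?_⟩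
  · rintro ⟨x, hx⟩ ⟨y, hy⟩
    exact ⟨T' y, by rw [← h, hy]; rfl⟩
  · rintro S hS _ ⟨x, hx, rfl⟩
    rw [Submodule.mkQ_apply, Submodule.mapQ_apply]
    exact congrArg _ (Subtype.ext (hS _ hx))
  · rintro S hS _ ⟨x, hx, rfl⟩
    rw [Submodule.mkQ_apply, Submodule.mapQ_apply]
    have : T.restrict hker x = 0 := Subtype.ext (hS _ hx)
    rw [this, Submodule.Quotient.mk_zero]

/-- If the projections to the total degree commute with `d`, a closed element of
`⨆_{p-q=k} W (p,q)` has closed components, so its class is a sum of classes of pure type. -/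
lemma cohSub_iSup_eq_iSup_cohSub {K M : Type*} [Field K] [AddCommGroup M] [Module K M]
    {W : ℤ × ℤ → Submodule K M} (htop : (⨆ pq, W pq) = ⊤) {d : M →ₗ[K] M}
    {P : ℤ → M →ₗ[K] M} (hP : ∀ i : ℤ × ℤ, ∀ x ∈ W i, P (i.1 + i.2) x = x)
    (hP' : ∀ (i : ℤ × ℤ) (n : ℤ), i.1 + i.2 ≠ n → ∀ x ∈ W i, P n x = 0)
    (hcomm : ∀ n x, P (n + 1) (d x) = d (P n x)) (k : ℤ) :
    cohSub d (⨆ (pq : ℤ × ℤ) (_ : pq.1 - pq.2 = k), W pq) =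
      ⨆ (pq : ℤ × ℤ) (_ : pq.1 - pq.2 = k), cohSub d (W pq) := by
  refine le_antisymm ?_ (iSup₂_le fun pq h =>
    cohSub_mono d (le_iSup₂ (f := fun (i : ℤ × ℤ) (_ : i.1 - i.2 = k) => W i) pq h))
  rintro _ ⟨⟨x, hxd⟩, hx, rfl⟩
  replace hx : x ∈ ⨆ (pq : ℤ × ℤ) (_ : pq.1 - pq.2 = k), W pq := hx
  have hmem : ∀ n, P n x ∈ W ((n + k) / 2, (n + k) / 2 - k) := by
    intro n
    suffices h : (⨆ (pq : ℤ × ℤ) (_ : pq.1 - pq.2 = k), W pq) ≤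
        (W ((n + k) / 2, (n + k) / 2 - k)).comap (P n) from
      Submodule.mem_comap.1 (h hx)
    refine iSup₂_le fun i hi y hy => ?_
    rw [Submodule.mem_comap]
    by_cases hn : i.1 + i.2 = n
    · have : i = ((n + k) / 2, (n + k) / 2 - k) := by ext <;> dsimp only <;> omega
      rw [← this, ← hn, hP i y hy]
      exact hy
    · rw [hP' i n hn y hy]
      exact zero_mem _
  have hker : ∀ n, P n x ∈ LinearMap.ker d := fun n => by
    rw [LinearMap.mem_ker, ← hcomm, LinearMap.mem_ker.1 hxd, map_zero]
  obtain ⟨s, hs⟩ := exists_finset_sum_coarse_projections_eq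
    (f := fun i : ℤ × ℤ => i.1 + i.2) htop hP hP' x
  have hsum : (⟨x, hxd⟩ : LinearMap.ker d) = ∑ n ∈ s, ⟨P n x, hker n⟩ :=
    Subtype.ext (by simp [hs])
  rw [hsum, map_sum]
  refine sum_mem fun n _ => ?_
  have hle : cohSub d (W ((n + k) / 2, (n + k) / 2 - k)) ≤
      ⨆ (pq : ℤ × ℤ) (_ : pq.1 - pq.2 = k), cohSub d (W pq) :=
    le_iSup₂ (f := fun (pq : ℤ × ℤ) (_ : pq.1 - pq.2 = k) => cohSub d (W pq))
      ((n + k) / 2, (n + k) / 2 - k) (by dsimp only; omega)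
  exact hle ⟨⟨P n x, hker n⟩, hmem n, rfl⟩

/-- If every component of `d` raises the total degree by one, so that `d` is homogeneous, then `d`
intertwines consecutive projections onto total degrees. -/
lemma totalDegree_projection_comm {K M : Type*} [Field K] [AddCommGroup M] [Module K M]
    {W : ℤ × ℤ → Submodule K M} (htop : (⨆ pq, W pq) = ⊤) {d A p q Abar : M →ₗ[K] M}
    (hsum : d = A + p + q + Abar)
    (hA : ∀ pq : ℤ × ℤ, (W pq).map A ≤ W (pq.1 + 2, pq.2 - 1))
    (hp : ∀ pq : ℤ × ℤ, (W pq).map p ≤ W (pq.1 + 1, pq.2))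
    (hq : ∀ pq : ℤ × ℤ, (W pq).map q ≤ W (pq.1, pq.2 + 1))
    (hAbar : ∀ pq : ℤ × ℤ, (W pq).map Abar ≤ W (pq.1 - 1, pq.2 + 2))
    {P : ℤ → M →ₗ[K] M} (hP : ∀ i : ℤ × ℤ, ∀ x ∈ W i, P (i.1 + i.2) x = x)
    (hP' : ∀ (i : ℤ × ℤ) (n : ℤ), i.1 + i.2 ≠ n → ∀ x ∈ W i, P n x = 0) (n : ℤ) (x : M) :
    P (n + 1) (d x) = d (P n x) := by
  have hx : x ∈ ⨆ i, W i := htop ▸ Submodule.mem_top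
  induction hx using Submodule.iSup_induction' with
  | mem i x hx =>
    have h1 := hA i (Submodule.mem_map_of_mem hx)
    have h2 := hp i (Submodule.mem_map_of_mem hx)
    have h3 := hq i (Submodule.mem_map_of_mem hx)
    have h4 := hAbar i (Submodule.mem_map_of_mem hx)
    by_cases hn : i.1 + i.2 = n
    · have hfix : ∀ j : ℤ × ℤ, j.1 + j.2 = n + 1 → ∀ y ∈ W j, P (n + 1) y = y :=
        fun j hj y hy => hj ▸ hP j y hy
      rw [← hn, hP i x hx, hn, hsum]
      simp only [LinearMap.add_apply, map_add]
      rw [hfix _ (by dsimp only; omega) _ h1, hfix _ (by dsimp only; omega) _ h2,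
        hfix _ (by dsimp only; omega) _ h3, hfix _ (by dsimp only; omega) _ h4]
    · rw [hP' i n hn x hx, hsum]
      simp only [LinearMap.add_apply, map_add, map_zero]
      rw [hP' _ (n + 1) (by dsimp only; omega) _ h1, hP' _ (n + 1) (by dsimp only; omega) _ h2,
        hP' _ (n + 1) (by dsimp only; omega) _ h3, hP' _ (n + 1) (by dsimp only; omega) _ h4]
      simp
  | zero => simp
  | add x y _ _ hx hy => simp only [map_add, hx, hy]

/-- C∞-pure-and-fullness of the generalized-almost-complex structure associated to an
almost-complex structure is equivalent to complex-C∞-pure-and-fullness at every stage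
in the sense of Li and Zhang (algebraic model): the subgroups
`GH^(k) = π '' ((⨆_{p-q=k} W(p,q)) ∩ ker d)` decompose `H = ker d ⧸ im d` iff the
subgroups `H^(p,q) = π '' (W(p,q) ∩ ker d)` do. -/
theorem stmt9 {K M : Type*} [Field K] [AddCommGroup M] [Module K M]
    (W : ℤ × ℤ → Submodule K M) (hindep : iSupIndep W) (htop : (⨆ pq, W pq) = ⊤)
    (d A p q Abar : M →ₗ[K] M)
    (hsum : d = A + p + q + Abar)
    (hA : ∀ pq : ℤ × ℤ, (W pq).map A ≤ W (pq.1 + 2, pq.2 - 1))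
    (hp : ∀ pq : ℤ × ℤ, (W pq).map p ≤ W (pq.1 + 1, pq.2))
    (hq : ∀ pq : ℤ × ℤ, (W pq).map q ≤ W (pq.1, pq.2 + 1))
    (hAbar : ∀ pq : ℤ × ℤ, (W pq).map Abar ≤ W (pq.1 - 1, pq.2 + 2))
    (hd : d ∘ₗ d = 0) :
    ((⨆ k : ℤ, cohSub d (⨆ (pq : ℤ × ℤ) (_ : pq.1 - pq.2 = k), W pq)) = ⊤ ∧
        iSupIndep (fun k : ℤ =>
          cohSub d (⨆ (pq : ℤ × ℤ) (_ : pq.1 - pq.2 = k), W pq)))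
      ↔
    ((⨆ pq : ℤ × ℤ, cohSub d (W pq)) = ⊤ ∧
        iSupIndep (fun pq : ℤ × ℤ => cohSub d (W pq))) := by
  obtain ⟨P, hP, hP'⟩ :=
    exists_coarse_projections W hindep htop fun i : ℤ × ℤ => i.1 + i.2
  have hcomm := totalDegree_projection_comm htop hsum hA hp hq hAbar hP hP'
  have hU := cohSub_iSup_eq_iSup_cohSub htop hP hP' hcomm
  have hle : ∀ pq : ℤ × ℤ, cohSub d (W pq) ≤
      ⨆ (i : ℤ × ℤ) (_ : i.1 - i.2 = pq.1 - pq.2), cohSub d (W i) := fun pq =>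
    le_iSup₂ (f := fun (i : ℤ × ℤ) (_ : i.1 - i.2 = pq.1 - pq.2) => cohSub d (W i)) pq rfl
  simp only [hU]
  refine and_congr ?_ ⟨fun h => ?_, fun h => ?_⟩
  · rw [iSup_comm]
    simp
  · intro pq
    obtain ⟨Q, hQ, hQ'⟩ := exists_cohomology_map d (P (pq.1 + pq.2)) (P (pq.1 + pq.2 - 1))
      (P (pq.1 + pq.2 + 1)) (fun x => by rw [← hcomm, sub_add_cancel]) (hcomm _)
    rw [Submodule.disjoint_def]
    intro v hv hv'
    refine Submodule.disjoint_def.1 (h (pq.1 - pq.2)) v (hle pq hv) ?_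
    rw [← hQ _ (hP pq) v hv]
    suffices hQle : (⨆ (i : ℤ × ℤ) (_ : i ≠ pq), cohSub d (W i)) ≤
        (⨆ (k : ℤ) (_ : k ≠ pq.1 - pq.2),
          ⨆ (i : ℤ × ℤ) (_ : i.1 - i.2 = k), cohSub d (W i)).comap Q from
      Submodule.mem_comap.1 (hQle hv')
    refine iSup₂_le fun i hi w hw => ?_
    rw [Submodule.mem_comap]
    by_cases hn : i.1 + i.2 = pq.1 + pq.2
    · rw [hQ _ (hn ▸ hP i) w hw]
      have hk : i.1 - i.2 ≠ pq.1 - pq.2 := fun hk => hi (by ext <;> omega)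
      exact (le_iSup₂_of_le (f := fun (k : ℤ) (_ : k ≠ pq.1 - pq.2) =>
        ⨆ (i : ℤ × ℤ) (_ : i.1 - i.2 = k), cohSub d (W i)) _ hk le_rfl) (hle i hw)
    · rw [hQ' _ (hP' i _ hn) w hw]
      exact zero_mem _
  · intro k
    have := h.disjoint_biSup_biSup (s := {i : ℤ × ℤ | i.1 - i.2 = k})
      (t := {i : ℤ × ℤ | i.1 - i.2 ≠ k})
      (Set.disjoint_left.2 fun i hi hi' => hi' hi)
    refine this.mono le_rfl (iSup₂_le fun j hj => iSup₂_le fun i hi => ?_)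
    exact le_iSup₂_of_le (f := fun i (_ : i ∈ {i : ℤ × ℤ | i.1 - i.2 ≠ k}) => cohSub d (W i))
      i (by simpa [hi] using hj) le_rfl
end

section
/- Let K be a field and M a K-vector space equipped with an internal ℤ-grading: a family U : ℤ → Submodule K M which is independent and satisfies ⨆ k, U k = ⊤. Let ∂, ∂̄ : M →ₗ[K] M be linear maps such that ∂ (U k) ⊆ U (k+1) and ∂̄ (U k) ⊆ U (k−1) for every k ∈ ℤ, and set d := ∂ + ∂̄ with d ∘ d = 0. Let H := ker d ⧸ im d with quotient map π and GH^(k) := π '' (U k ∩ ker d). Suppose in addition that there is a bilinear form B : H →ₗ[K] H →ₗ[K] K which is nondegenerate (if B x y = 0 for all y then x = 0, and if B x y = 0 for all x then y = 0) and satisfies B a b = 0 whenever a ∈ GH^(h), b ∈ GH^(k) and h + k ≠ 0. Then the following are equivalent: (i) for every x ∈ ker d there exists a finitely supported family (x_k)_{k ∈ ℤ} with x_k ∈ U k, ∂ x_k = 0, ∂̄ x_k = 0, and x − ∑_k x_k ∈ im d; (ii) ⨆ k, GH^(k) = ⊤ and the family (GH^(k))_{k ∈ ℤ} is independent, i.e.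 H = ⊕_k GH^(k). -/
/-- A homogeneous `p + q`-closed element is both `p`-closed and `q`-closed. -/
theorem eq_zero_and_eq_zero_of_mem_of_add_eq_zero {K M : Type*} [Field K] [AddCommGroup M]
    [Module K M] {U : ℤ → Submodule K M} (hindep : iSupIndep U) {p q : M →ₗ[K] M}
    (hp : ∀ k : ℤ, (U k).map p ≤ U (k + 1)) (hq : ∀ k : ℤ, (U k).map q ≤ U (k - 1))
    {k : ℤ} {v : M} (hv : v ∈ U k) (hdv : (p + q) v = 0) : p v = 0 ∧ q v = 0 := by
  have hsum : p v + q v = 0 := hdv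
  have hpv : p v ∈ U (k + 1) := hp k (Submodule.mem_map_of_mem hv)
  have hqv : q v ∈ U (k - 1) := hq k (Submodule.mem_map_of_mem hv)
  have hpv' : p v ∈ U (k - 1) := by
    rw [eq_neg_of_add_eq_zero_left hsum]
    exact neg_mem hqv
  have h0 : p v = 0 :=
    Submodule.disjoint_def.mp (hindep.pairwiseDisjoint (show k + 1 ≠ k - 1 by lia)) _ hpv hpv'
  exact ⟨h0, by simpa [h0] using hsum⟩

/-- Subspaces spanning a vector space are independent if they are orthogonal, outside opposite
degrees, for a bilinear form with trivial left kernel. -/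
theorem iSupIndep_of_bilin_eq_zero {K H : Type*} [Field K] [AddCommGroup H] [Module K H]
    (G : ℤ → Submodule K H) (B : H →ₗ[K] H →ₗ[K] K)
    (hB : ∀ x, (∀ y, B x y = 0) → x = 0)
    (horth : ∀ h k : ℤ, h + k ≠ 0 → ∀ a ∈ G h, ∀ b ∈ G k, B a b = 0)
    (htop : (⨆ k, G k) = ⊤) : iSupIndep G := by
  intro k
  refine Submodule.disjoint_def.mpr fun a ha ha' => hB a fun y => ?_
  suffices h : (⨆ k, G k) ≤ LinearMap.ker (B a) from h (htop ▸ Submodule.mem_top)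
  refine iSup_le fun h b hb => ?_
  rw [LinearMap.mem_ker]
  by_cases hk : k + h = 0
  · have hle : (⨆ j, ⨆ (_ : j ≠ k), G j) ≤ LinearMap.ker (B.flip b) :=
      iSup₂_le fun j hj c hc => horth j h (by lia) c hc b hb
    exact hle ha'
  · exact horth k h hk a ha b hb

/-- A generalized-complex structure is C∞-pure-and-full iff the Bott-Chern-to-de-Rham
map is surjective (algebraic model): given a nondegenerate pairing on `H = ker d ⧸ im d`
vanishing on `GH^(h) × GH^(k)` for `h + k ≠ 0`, the condition that every `d`-closed
element is, modulo `im d`, a finite sum of `∂`- and `∂̄`-closed elements of the `U^k`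
is equivalent to `H = ⊕ₖ GH^(k)`. -/
theorem stmt10 {K M : Type*} [Field K] [AddCommGroup M] [Module K M]
    (U : ℤ → Submodule K M) (hindep : iSupIndep U) (htop : (⨆ k, U k) = ⊤)
    (p q : M →ₗ[K] M)
    (hp : ∀ k : ℤ, (U k).map p ≤ U (k + 1))
    (hq : ∀ k : ℤ, (U k).map q ≤ U (k - 1))
    (hd : (p + q) ∘ₗ (p + q) = 0)
    (B : (↥(LinearMap.ker (p + q)) ⧸
            (LinearMap.range (p + q)).comap (LinearMap.ker (p + q)).subtype) →ₗ[K]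
          (↥(LinearMap.ker (p + q)) ⧸
            (LinearMap.range (p + q)).comap (LinearMap.ker (p + q)).subtype) →ₗ[K] K)
    (hB1 : ∀ x, (∀ y, B x y = 0) → x = 0)
    (hB2 : ∀ y, (∀ x, B x y = 0) → y = 0)
    (horth : ∀ h k : ℤ, h + k ≠ 0 →
      ∀ a ∈ GHsub (p + q) (U h), ∀ b ∈ GHsub (p + q) (U k), B a b = 0) :
    (∀ x : M, (p + q) x = 0 →
        ∃ c : ℤ →₀ M, (∀ k : ℤ, c k ∈ U k) ∧ (∀ k : ℤ, p (c k) = 0) ∧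
          (∀ k : ℤ, q (c k) = 0) ∧
          x - (c.sum fun _ v => v) ∈ LinearMap.range (p + q))
      ↔
    ((⨆ k, GHsub (p + q) (U k)) = ⊤ ∧ iSupIndep (fun k => GHsub (p + q) (U k))) := by
  constructor
  · intro hrep
    have hfull : (⨆ k, GHsub (p + q) (U k)) = ⊤ := by
      refine eq_top_iff.mpr fun y _ => ?_
      obtain ⟨⟨x, hx⟩, rfl⟩ := Submodule.mkQ_surjective _ y
      obtain ⟨c, hcU, hcp, hcq, hxc⟩ := hrep x hx
      have hc : ∀ k, c k ∈ LinearMap.ker (p + q) := fun k => by simp [hcp, hcq]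
      let w : LinearMap.ker (p + q) := ∑ k ∈ c.support, ⟨c k, hc k⟩
      have hxw : Submodule.mkQ ((LinearMap.range (p + q)).comap (LinearMap.ker (p + q)).subtype)
          ⟨x, hx⟩ = Submodule.mkQ _ w := by
        refine (Submodule.Quotient.eq _).mpr ?_
        simpa [w, Finsupp.sum] using hxc
      rw [hxw, map_sum]
      exact Submodule.sum_mem _ fun k _ => Submodule.mem_iSup_of_mem k
        (Submodule.mem_map_of_mem (hcU k))
    exact ⟨hfull, iSupIndep_of_bilin_eq_zero _ B hB1 horth hfull⟩
  · rintro ⟨hfull, -⟩ x hx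
    simp only [GHsub, ← Submodule.map_iSup] at hfull
    obtain ⟨w, hw, hwx⟩ := hfull.ge (Submodule.mem_top (x := Submodule.mkQ _ ⟨x, hx⟩))
    obtain ⟨f, hfU, rfl⟩ := (Submodule.mem_iSup_iff_exists_finsupp _ _).mp hw
    have hpq k := eq_zero_and_eq_zero_of_mem_of_add_eq_zero hindep hp hq (hfU k) (f k).2
    refine ⟨f.mapRange (LinearMap.ker (p + q)).subtype (map_zero _), hfU,
      fun k => (hpq k).1, fun k => (hpq k).2, ?_⟩
    have hmem := (Submodule.Quotient.eq _).mp hwx.symm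
    rw [Finsupp.sum_mapRange_index fun _ => rfl]
    simpa [Finsupp.sum] using hmem
end
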